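/- arXiv:2206.10712 — 3 statements merged into one kernel-verified Lean document; each statement's English description precedes it below -/
import Mathlib

section
/- Let G be a countable MIF group. For every n ∈ ℕ and all tuples ā = (a₁,…,aₙ) ∈ Gⁿ and d̄ = (d₁,…,dₙ) ∈ ℕⁿ, the set D(ā,d̄) is open and dense in L(G). -/
open Set Function Pointwise

section Defs

variable {G : Type*} [Group G]

/-- A length function on a group. -/
def IsLengthFun (ℓ : G → ℕ) : Prop :=
  (∀ g : G, ℓ g = 0 ↔ g = 1) ∧ (∀ g : G, ℓ g⁻¹ = ℓ g) ∧ ∀ g h : G, ℓ (g * h) ≤ ℓ g + ℓ h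

/-- The space of length functions, topologized as a subspace of `G → ℕ`. -/
abbrev LengthFun (G : Type*) [Group G] : Type _ := {ℓ : G → ℕ // IsLengthFun ℓ}

/-- Word length with respect to a generating set `X`. -/
noncomputable def wordLength (X : Set G) (g : G) : ℕ :=
  sInf {n : ℕ | ∃ w : List G, w.length = n ∧ (∀ x ∈ w, x ∈ X ∨ x⁻¹ ∈ X) ∧ w.prod = g}

/-- A length function is a word length. -/
def IsWordLength (ℓ : G → ℕ) : Prop :=
  ∃ X : Set G, Subgroup.closure X = ⊤ ∧ ∀ g : G, ℓ g = wordLength X g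

/-- Mixed identity free group. -/
def MIF (G : Type*) [Group G] : Prop :=
  ∀ w : Monoid.Coprod G (FreeGroup Unit), w ≠ 1 →
    ∃ g : G, Monoid.Coprod.lift (MonoidHom.id G) (FreeGroup.lift fun _ => g) w ≠ 1

/-- The length function associated to a weight function `ω`. -/
noncomputable def weightLength (ω : G → ℕ) (g : G) : ℕ :=
  sInf {N : ℕ | ∃ w : List (G × Bool),
    (w.map fun p => ω p.1).sum = N ∧
    (w.map fun p => if p.2 then p.1 else p.1⁻¹).prod = g}

/-- `(ℓ, a)`-consistency of a tuple of distances. -/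
def Consistent (ℓ : G → ℕ) {n : ℕ} (a : Fin n → G) (d : Fin n → ℕ) : Prop :=
  ∀ i j : Fin n, d i ≤ ℓ ((a i)⁻¹ * a j) + d j ∧ ℓ ((a i)⁻¹ * a j) ≤ d i + d j

/-- The bi-Lipschitz preorder on length functions. -/
def Preceq (ℓ₁ ℓ₂ : G → ℕ) : Prop :=
  ∃ C : ℕ, ∀ g : G, g ≠ 1 → ℓ₁ g ≤ C * ℓ₂ g

/-- The conjugacy action of `G` on its space of length functions. -/
def conjLF (g : G) (ℓ : LengthFun G) : LengthFun G :=
  ⟨fun x => ℓ.1 (g⁻¹ * x * g), by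
    obtain ⟨h1, h2, h3⟩ := ℓ.2
    refine ⟨fun x => ?_, fun x => ?_, fun x y => ?_⟩
    · rw [h1]
      constructor
      · intro h
        have := congrArg (fun z => g * z * g⁻¹) h
        simpa [mul_assoc] using this
      · rintro rfl; simp
    · show ℓ.1 (g⁻¹ * x⁻¹ * g) = ℓ.1 (g⁻¹ * x * g)
      have h : g⁻¹ * x⁻¹ * g = (g⁻¹ * x * g)⁻¹ := by group
      rw [h, h2]
    · show ℓ.1 (g⁻¹ * (x * y) * g) ≤ ℓ.1 (g⁻¹ * x * g) + ℓ.1 (g⁻¹ * y * g)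
      have h : g⁻¹ * (x * y) * g = (g⁻¹ * x * g) * (g⁻¹ * y * g) := by group
      rw [h]
      exact h3 _ _⟩

/-- Topological transitivity of the conjugacy action on `LengthFun G`. -/
def ConjTopTransitive (G : Type*) [Group G] : Prop :=
  ∀ U V : Set (LengthFun G), IsOpen U → IsOpen V → U.Nonempty → V.Nonempty →
    ∃ g : G, ((conjLF g '' U) ∩ V).Nonempty

end Defs

/-- The language with one binary function symbol and countably many unary predicates. -/
def lengthLang : FirstOrder.Language where
  Functions := fun n => match n with | 2 => Unit | _ => Empty
  Relations := fun n => match n with | 1 => ℕ | _ => Empty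

/-- The `lengthLang`-structure on `G` associated to a length function `ℓ`. -/
def lengthStructure {G : Type*} [Group G] (ℓ : G → ℕ) : lengthLang.Structure G where
  funMap {n} f x :=
    match n, f, x with
    | 2, _, x => x 0 * x 1
  RelMap {n} r x :=
    match n, r, x with
    | 1, i, x => ℓ (x 0) = i

section FreeProducts

universe u

open Monoid Monoid.CoprodI

namespace Monoid.CoprodI

variable {ι : Type*} {H : ι → Type*} [∀ i, Group (H i)]

theorem NeWord.prod_ne_one {i j : ι} (w : NeWord H i j) : w.prod ≠ 1 := by
  classical
  intro h
  have h' : w.toWord = Word.empty :=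
    (Word.equiv (M := H)).symm.injective (h.trans Word.prod_empty.symm)
  exact w.toList_ne_nil (congrArg Word.toList h')

theorem exists_neWord_prod_eq {w : CoprodI H} (hw : w ≠ 1) :
    ∃ (i j : ι) (v : NeWord H i j), v.prod = w := by
  classical
  have hne : Word.equiv w ≠ Word.empty := by
    intro h
    apply hw
    rw [← Word.equiv.symm_apply_apply w, h]
    simp [Word.equiv]
  obtain ⟨i, j, v, hv⟩ := NeWord.of_word _ hne
  refine ⟨i, j, v, ?_⟩
  rw [NeWord.prod, hv]
  exact Word.equiv.symm_apply_apply w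

/-- Conjugating by a suitable element of the factor `H i`, a nontrivial element of a free product
acquires a reduced word that starts and ends in `H i`. -/
theorem exists_conj_neWord {i : ι} {s t : H i} (hs : s ≠ 1) (ht : t ≠ 1) (hst : s ≠ t)
    {w : CoprodI H} (hw : w ≠ 1) :
    ∃ (c : CoprodI H) (v : NeWord H i i), v.prod = c * w * c⁻¹ := by
  have mixed : ∀ {j : ι} (_ : j ≠ i) (v : NeWord H i j),
      ∃ (c : CoprodI H) (v' : NeWord H i i), v'.prod = c * v.prod * c⁻¹ := by
    intro j hj v
    obtain ⟨r, hr, hrv⟩ : ∃ r : H i, r ≠ 1 ∧ r * v.head ≠ 1 := by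
      by_cases h : s * v.head = 1
      · exact ⟨t, ht, fun h' => hst (mul_right_cancel (h.trans h'.symm))⟩
      · exact ⟨s, hs, h⟩
    exact ⟨of r, (v.mulHead r hrv).append hj (.singleton r⁻¹ (inv_ne_one.mpr hr)), by simp⟩
  obtain ⟨j, k, v, rfl⟩ := exists_neWord_prod_eq hw
  by_cases hj : j = i
  · subst hj
    by_cases hk : k = j
    · subst hk
      exact ⟨1, v, by simp⟩
    · exact mixed hk v
  · by_cases hk : k = i
    · subst hk
      obtain ⟨c, v', hv'⟩ := mixed hj v.inv
      exact ⟨c, v'.inv, by rw [NeWord.inv_prod, hv', NeWord.inv_prod]; group⟩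
    · exact ⟨of s, ((NeWord.singleton s hs).append (Ne.symm hj) v).append hk
        (.singleton s⁻¹ (inv_ne_one.mpr hs)), by simp⟩

theorem exists_not_commute_conj {i k : ι} (hik : i ≠ k) {s t : H i} (hs : s ≠ 1) (ht : t ≠ 1)
    (hst : s ≠ t) {u : H k} (hu : u ≠ 1) {a b : CoprodI H} (ha : a ≠ 1) (hb : b ≠ 1) :
    ∃ c e : CoprodI H, ¬ Commute (c * a * c⁻¹) (e * b * e⁻¹) := by
  obtain ⟨c, v, hv⟩ := exists_conj_neWord hs ht hst ha
  obtain ⟨e, v', hv'⟩ := exists_conj_neWord hs ht hst hb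
  let z : NeWord H k k := ((NeWord.singleton u hu).append hik.symm v').append hik
    (.singleton u⁻¹ (inv_ne_one.mpr hu))
  refine ⟨c, of u * e, fun hcomm => ?_⟩
  have hz : z.prod = of u * e * b * (of u * e)⁻¹ := by
    simp [z, hv', mul_assoc]
  apply ((v.append hik z).append hik.symm (v.inv.append hik z.inv)).prod_ne_one
  simp only [NeWord.append_prod, NeWord.inv_prod]
  rw [← hv, ← hz] at hcomm
  rw [hcomm.eq]
  group

end Monoid.CoprodI

namespace Monoid.Coprod

variable {A B : Type u} [Group A] [Group B]

instance (b : Bool) : Group (cond b A B) := by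
  cases b <;> dsimp only [cond] <;> infer_instance

/-- A binary free product is a free product indexed by `Bool`. -/
def toCoprodI (A B : Type u) [Group A] [Group B] : Coprod A B →* CoprodI fun b => cond b A B :=
  Coprod.lift (CoprodI.of (M := fun b => cond b A B) (i := true))
    (CoprodI.of (M := fun b => cond b A B) (i := false))

/-- The inverse of `toCoprodI`. -/
def ofCoprodI (A B : Type u) [Group A] [Group B] : (CoprodI fun b => cond b A B) →* Coprod A B :=
  CoprodI.lift fun b => match b with
    | true => Coprod.inl
    | false => Coprod.inr

theorem ofCoprodI_toCoprodI (w : Coprod A B) : ofCoprodI A B (toCoprodI A B w) = w := by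
  have h : (ofCoprodI A B).comp (toCoprodI A B) = MonoidHom.id _ := by
    refine Coprod.hom_ext ?_ ?_ <;> ext x <;> rfl
  exact DFunLike.congr_fun h w

theorem toCoprodI_ofCoprodI (w : CoprodI fun b => cond b A B) :
    toCoprodI A B (ofCoprodI A B w) = w := by
  have h : (toCoprodI A B).comp (ofCoprodI A B) = MonoidHom.id _ := by
    refine CoprodI.ext_hom _ _ fun b => ?_
    cases b <;> rfl
  exact DFunLike.congr_fun h w

theorem exists_not_commute_conj [Nontrivial A] {s t : B} (hs : s ≠ 1) (ht : t ≠ 1)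
    (hst : s ≠ t) {a b : Coprod A B} (ha : a ≠ 1) (hb : b ≠ 1) :
    ∃ c e : Coprod A B, ¬ Commute (c * a * c⁻¹) (e * b * e⁻¹) := by
  obtain ⟨u, hu⟩ := exists_ne (1 : A)
  have hinj : Function.Injective (toCoprodI A B) :=
    Function.LeftInverse.injective ofCoprodI_toCoprodI
  obtain ⟨c, e, hce⟩ := CoprodI.exists_not_commute_conj (H := fun b => cond b A B)
    (i := false) (k := true) (by simp) hs ht hst hu
    ((map_ne_one_iff _ hinj).2 ha) ((map_ne_one_iff _ hinj).2 hb)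
  refine ⟨ofCoprodI A B c, ofCoprodI A B e, fun h => hce ?_⟩
  simpa [toCoprodI_ofCoprodI] using h.map (toCoprodI A B)

end Monoid.Coprod

end FreeProducts

section MIF

open scoped commutatorElement

variable {G : Type} [Group G]

/-- Evaluation of a mixed word at an element. -/
abbrev mixedEval (g : G) : Monoid.Coprod G (FreeGroup Unit) →* G :=
  Monoid.Coprod.lift (MonoidHom.id G) (FreeGroup.lift fun _ => g)

theorem MIF.nontrivial (hG : MIF G) : Nontrivial G := by
  have hx : (Monoid.Coprod.inr (FreeGroup.of ()) : Monoid.Coprod G (FreeGroup Unit)) ≠ 1 :=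
    (map_ne_one_iff _ Monoid.Coprod.inr_injective).2 (FreeGroup.of_ne_one ())
  obtain ⟨g, hg⟩ := hG _ hx
  exact ⟨_, _, hg⟩

/-- In a MIF group finitely many nontrivial mixed words are nontrivial at a common element. -/
theorem MIF.exists_forall_ne_one (hG : MIF G) (S : Finset (Monoid.Coprod G (FreeGroup Unit)))
    (hS : ∀ w ∈ S, w ≠ 1) : ∃ g : G, ∀ w ∈ S, mixedEval g w ≠ 1 := by
  classical
  have := hG.nontrivial
  have hx : (FreeGroup.of () : FreeGroup Unit) ≠ 1 := FreeGroup.of_ne_one ()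
  have hxx : (FreeGroup.of () : FreeGroup Unit) ≠ FreeGroup.of () ^ 2 := by
    intro h
    apply hx
    rw [pow_two] at h
    exact left_eq_mul.1 h
  have hx2 : (FreeGroup.of () ^ 2 : FreeGroup Unit) ≠ 1 := by
    intro h
    exact hx ((pow_eq_one_iff_left two_ne_zero).1 h)
  suffices ∃ v : Monoid.Coprod G (FreeGroup Unit), v ≠ 1 ∧
      ∀ g : G, mixedEval g v ≠ 1 → ∀ w ∈ S, mixedEval g w ≠ 1 by
    obtain ⟨v, hv, h⟩ := this
    obtain ⟨g, hg⟩ := hG v hv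
    exact ⟨g, h g hg⟩
  induction S using Finset.induction_on with
  | empty =>
    exact ⟨Monoid.Coprod.inr (FreeGroup.of ()),
      (map_ne_one_iff _ Monoid.Coprod.inr_injective).2 hx, by simp⟩
  | insert a S _ ih =>
    obtain ⟨v, hv, h⟩ := ih fun w hw => hS w (Finset.mem_insert_of_mem hw)
    obtain ⟨c, e, hce⟩ := Monoid.Coprod.exists_not_commute_conj hx hx2 hxx
      (hS a (Finset.mem_insert_self a S)) hv
    refine ⟨⁅c * a * c⁻¹, e * v * e⁻¹⁆, fun h1 => hce (commutatorElement_eq_one_iff_commute.1 h1),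
      fun g hg => ?_⟩
    rw [map_commutatorElement, map_mul, map_mul, map_mul, map_mul] at hg
    have ha : mixedEval g a ≠ 1 := fun h1 => hg (by simp [h1])
    have hv' : mixedEval g v ≠ 1 := fun h1 => hg (by simp [h1])
    intro w hw
    rcases Finset.mem_insert.1 hw with rfl | hw
    · exact ha
    · exact h g hv' w hw

end MIF

section RelLength

variable {G : Type} [Group G]

/-- The least total weight of a factorization of `g` into letters with weights allowed by `R`. -/
noncomputable def relLength (R : Set (G × ℕ)) (g : G) : ℕ :=
  sInf {N : ℕ | ∃ w : List (G × ℕ), (∀ p ∈ w, p ∈ R) ∧ (w.map Prod.snd).sum = N ∧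
    (w.map Prod.fst).prod = g}

theorem relLength_le {R : Set (G × ℕ)} {w : List (G × ℕ)} (hw : ∀ p ∈ w, p ∈ R) :
    relLength R (w.map Prod.fst).prod ≤ (w.map Prod.snd).sum :=
  Nat.sInf_le ⟨w, hw, rfl, rfl⟩

theorem relLength_le_of_mem {R : Set (G × ℕ)} {g : G} {k : ℕ} (h : (g, k) ∈ R) :
    relLength R g ≤ k := by
  simpa using relLength_le (R := R) (w := [(g, k)]) (by simpa using h)

theorem relLength_one (R : Set (G × ℕ)) : relLength R 1 = 0 := by
  simpa using relLength_le (R := R) (w := []) (by simp)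

theorem exists_relLength_eq {R : Set (G × ℕ)} (hR : ∀ g, ∃ k, (g, k) ∈ R) (g : G) :
    ∃ w : List (G × ℕ), (∀ p ∈ w, p ∈ R) ∧ (w.map Prod.snd).sum = relLength R g ∧
      (w.map Prod.fst).prod = g := by
  obtain ⟨k, hk⟩ := hR g
  exact Nat.sInf_mem (s := {N : ℕ | ∃ w : List (G × ℕ), (∀ p ∈ w, p ∈ R) ∧
    (w.map Prod.snd).sum = N ∧ (w.map Prod.fst).prod = g})
    ⟨k, [(g, k)], by simpa using hk, by simp, by simp⟩

theorem isLengthFun_relLength {R : Set (G × ℕ)} (hR : ∀ g, ∃ k, (g, k) ∈ R)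
    (hpos : ∀ p ∈ R, 0 < p.2) (hinv : ∀ p ∈ R, (p.1⁻¹, p.2) ∈ R) :
    IsLengthFun (relLength R) := by
  have inv_le : ∀ g : G, relLength R g⁻¹ ≤ relLength R g := by
    intro g
    obtain ⟨w, hw, hsum, hprod⟩ := exists_relLength_eq hR g
    have h := relLength_le (R := R) (w := (w.map fun p => (p.1⁻¹, p.2)).reverse) (by
      intro p hp
      obtain ⟨q, hq, rfl⟩ := List.mem_map.1 (List.mem_reverse.1 hp)
      exact hinv q (hw q hq))
    have h1 : ((w.map fun p => (p.1⁻¹, p.2)).reverse.map Prod.fst).prod = g⁻¹ := by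
      rw [← hprod, List.prod_inv_reverse, List.map_reverse, List.map_map, List.map_map]
      rfl
    have h2 : ((w.map fun p => (p.1⁻¹, p.2)).reverse.map Prod.snd).sum = relLength R g := by
      rw [← hsum, List.map_reverse, List.sum_reverse, List.map_map]
      rfl
    rwa [h1, h2] at h
  refine ⟨fun g => ⟨fun h => ?_, fun h => h ▸ relLength_one R⟩, fun g => ?_, fun g h => ?_⟩
  · obtain ⟨w, hw, hsum, hprod⟩ := exists_relLength_eq hR g
    rw [h] at hsum
    cases w with
    | nil => simpa using hprod.symm
    | cons p w =>
      have := hpos p (hw p (by simp))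
      simp at hsum
      omega
  · exact le_antisymm (inv_le g) (by simpa using inv_le g⁻¹)
  · obtain ⟨w, hw, hsum, hprod⟩ := exists_relLength_eq hR g
    obtain ⟨w', hw', hsum', hprod'⟩ := exists_relLength_eq hR h
    have := relLength_le (R := R) (w := w ++ w') (by
      intro p hp
      rcases List.mem_append.1 hp with hp | hp
      · exact hw p hp
      · exact hw' p hp)
    simpa [hsum, hsum', hprod, hprod'] using this

end RelLength

section Approximation

variable {G : Type} [Group G]

theorem map_list_prod_le_sum {Γ : Type*} [Monoid Γ] {L : Γ → ℕ∞} (h1 : L 1 = 0)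
    (hmul : ∀ u v, L (u * v) ≤ L u + L v) (w : List Γ) : L w.prod ≤ (w.map L).sum := by
  induction w with
  | nil => simp [h1]
  | cons u w ih =>
    simpa using (hmul u w.prod).trans (add_le_add le_rfl ih)

/-- A seminorm on mixed words can be realized on finitely many mixed words by a length function on
a MIF group, after evaluation at a suitable element. -/
theorem MIF.exists_lengthFun (hG : MIF G) (L : Monoid.Coprod G (FreeGroup Unit) → ℕ∞)
    (h1 : L 1 = 0) (hinv : ∀ u, L u⁻¹ = L u) (hmul : ∀ u v, L (u * v) ≤ L u + L v)
    (T : Finset (Monoid.Coprod G (FreeGroup Unit))) (hpos : ∀ t ∈ T, t ≠ 1 → L t ≠ 0)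
    (hfin : ∀ t ∈ T, L t ≠ ⊤) :
    ∃ (g : G) (ℓ : LengthFun G), ∀ t ∈ T, (ℓ.1 (mixedEval g t) : ℕ∞) = L t := by
  classical
  let S : Set (Monoid.Coprod G (FreeGroup Unit)) := {u | u ≠ 1 ∧ (u ∈ T ∨ u⁻¹ ∈ T)}
  have hSfin : S.Finite := by
    refine (T.finite_toSet.union T.finite_toSet.inv).subset ?_
    rintro u ⟨_, hu | hu⟩
    · exact Or.inl hu
    · exact Or.inr hu
  have hSpos : ∀ u ∈ S, L u ≠ 0 := by
    rintro u ⟨hu1, hu | hu⟩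
    · exact hpos u hu hu1
    · exact hinv u ▸ hpos _ hu (inv_ne_one.2 hu1)
  have hSinv : ∀ u ∈ S, u⁻¹ ∈ S := by
    rintro u ⟨hu1, hu⟩
    exact ⟨inv_ne_one.2 hu1, by rw [inv_inv]; exact hu.symm⟩
  let N : ℕ := 1 + ∑ t ∈ T, (L t).toNat
  have hN : ∀ t ∈ T, L t ≤ N := by
    intro t ht
    have h := Finset.single_le_sum (f := fun t => (L t).toNat) (fun _ _ => Nat.zero_le _) ht
    rw [← ENat.natCast_toNat (hfin t ht)]
    exact_mod_cast h.trans (Nat.le_add_left _ 1)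
  have hfinite := hSfin.to_subtype
  let W : Set (Monoid.Coprod G (FreeGroup Unit)) :=
    (fun w : List S => (w.map Subtype.val).prod) '' {w | w.length ≤ N}
  have hW : W.Finite := (List.finite_length_le S N).image _
  let B : Set (Monoid.Coprod G (FreeGroup Unit)) := (W⁻¹ * (T : Set _)) \ {1}
  have hB : B.Finite := (hW.inv.mul T.finite_toSet).sdiff
  obtain ⟨g, hg⟩ := hG.exists_forall_ne_one hB.toFinset fun w hw =>
    (hB.mem_toFinset.1 hw).2
  let R : Set (G × ℕ) := {p | N ≤ p.2 ∨ ∃ u ∈ S, mixedEval g u = p.1 ∧ L u = p.2}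
  have hR : IsLengthFun (relLength R) := by
    refine isLengthFun_relLength (fun h => ⟨N, Or.inl le_rfl⟩) ?_ ?_
    · rintro p (hp | ⟨u, hu, _, hp⟩)
      · omega
      · have := hSpos u hu
        rw [hp] at this
        exact Nat.pos_of_ne_zero (by exact_mod_cast this)
    · rintro p (hp | ⟨u, hu, hp, hp'⟩)
      · exact Or.inl hp
      · exact Or.inr ⟨u⁻¹, hSinv u hu, by rw [map_inv, hp], by rw [hinv, hp']⟩
  refine ⟨g, ⟨relLength R, hR⟩, fun t ht => le_antisymm ?_ ?_⟩
  · by_cases ht1 : t = 1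
    · simp [ht1, relLength_one]
    · rw [← ENat.natCast_toNat (hfin t ht)]
      have hmem : (mixedEval g t, (L t).toNat) ∈ R :=
        Or.inr ⟨t, ⟨ht1, Or.inl ht⟩, rfl, (ENat.natCast_toNat (hfin t ht)).symm⟩
      exact_mod_cast relLength_le_of_mem hmem
  · obtain ⟨w, hw, hsum, hprod⟩ :=
      exists_relLength_eq (R := R) (fun h => ⟨N, Or.inl le_rfl⟩) (mixedEval g t)
    change L t ≤ (relLength R (mixedEval g t) : ℕ∞)
    rcases le_or_gt N (relLength R (mixedEval g t)) with hle | hlt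
    · exact (hN t ht).trans (by exact_mod_cast hle)
    have hlift : ∀ w : List (G × ℕ), (∀ p ∈ w, p ∈ R) → (w.map Prod.snd).sum < N →
        ∃ v : List S, v.length ≤ (w.map Prod.snd).sum ∧
          mixedEval g (v.map Subtype.val).prod = (w.map Prod.fst).prod ∧
          ((v.map Subtype.val).map L).sum = ((w.map Prod.snd).sum : ℕ) := by
      intro w
      induction w with
      | nil => exact fun _ _ => ⟨[], by simp⟩
      | cons p w ih =>
        intro hw hlt
        rw [List.map_cons, List.sum_cons] at hlt
        obtain ⟨v, hv1, hv2, hv3⟩ := ih (fun q hq => hw q (List.mem_cons_of_mem p hq)) (by omega)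
        rcases hw p List.mem_cons_self with hp | ⟨u, hu, hp, hp'⟩
        · omega
        have hp0 : p.2 ≠ 0 := fun h0 => hSpos u hu (by rw [hp', h0]; rfl)
        refine ⟨⟨u, hu⟩ :: v, ?_, ?_, ?_⟩
        · simp only [List.length_cons, List.map_cons, List.sum_cons]
          omega
        · simp only [List.map_cons, List.prod_cons, map_mul, hv2, hp]
        · simp only [List.map_cons, List.sum_cons, hv3, hp', Nat.cast_add]
    obtain ⟨v, hv1, hv2, hv3⟩ := hlift w hw (hsum ▸ hlt)
    have hvt : (v.map Subtype.val).prod = t := by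
      by_contra hne
      refine hg ((v.map Subtype.val).prod⁻¹ * t) (hB.mem_toFinset.2 ⟨?_, ?_⟩) ?_
      · refine Set.mul_mem_mul (Set.inv_mem_inv.2 ⟨v, ?_, rfl⟩) ht
        exact hv1.trans (hsum ▸ hlt).le
      · exact fun h => hne (inv_mul_eq_one.1 h)
      · rw [map_mul, map_inv, hv2, hprod, inv_mul_cancel]
    rw [← hsum, ← hv3, ← hvt]
    exact map_list_prod_le_sum h1 hmul _

end Approximation

section SupDist

variable {X : Type*}

/-- The uniform distance between integer-valued functions. -/
noncomputable def supDist (φ ψ : X → ℤ) : ℕ∞ := ⨆ h, ((φ h - ψ h).natAbs : ℕ∞)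

theorem supDist_le_iff {φ ψ : X → ℤ} {k : ℕ} : supDist φ ψ ≤ k ↔ ∀ h, |φ h - ψ h| ≤ k := by
  simp only [supDist, iSup_le_iff, Nat.cast_le]
  exact forall_congr' fun h => by rw [Int.abs_eq_natAbs, Nat.cast_le]

theorem supDist_eq {φ ψ : X → ℤ} {k : ℕ} (hle : ∀ h, |φ h - ψ h| ≤ k) {h : X}
    (hh : |φ h - ψ h| = k) : supDist φ ψ = k := by
  refine le_antisymm (supDist_le_iff.2 hle) (le_iSup_of_le h ?_)
  rw [Int.abs_eq_natAbs] at hh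
  exact_mod_cast hh.ge

theorem supDist_self (φ : X → ℤ) : supDist φ φ = 0 := by
  simp [supDist]

theorem supDist_comm (φ ψ : X → ℤ) : supDist φ ψ = supDist ψ φ := by
  unfold supDist
  exact iSup_congr fun h => by rw [← Int.natAbs_neg, neg_sub]

theorem supDist_triangle (φ ψ χ : X → ℤ) : supDist φ χ ≤ supDist φ ψ + supDist ψ χ := by
  refine iSup_le fun h => ?_
  calc ((φ h - χ h).natAbs : ℕ∞) ≤ (((φ h - ψ h).natAbs + (ψ h - χ h).natAbs : ℕ) : ℕ∞) := by
        exact_mod_cast (by omega)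
    _ = ((φ h - ψ h).natAbs : ℕ∞) + ((ψ h - χ h).natAbs : ℕ∞) := by push_cast; rfl
    _ ≤ _ := add_le_add (le_iSup (fun h => ((φ h - ψ h).natAbs : ℕ∞)) h)
        (le_iSup (fun h => ((ψ h - χ h).natAbs : ℕ∞)) h)

end SupDist

section Extension

variable {G : Type} [Group G]

/-- Left translation of integer-valued functions. -/
def shiftHom (G : Type) [Group G] : G →* Equiv.Perm (G → ℤ) where
  toFun g := (Equiv.mulLeft g⁻¹).symm.arrowCongr (Equiv.refl ℤ)
  map_one' := by ext φ h; simp [Equiv.arrowCongr]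
  map_mul' g g' := by ext φ h; simp [Equiv.arrowCongr, mul_assoc]

theorem shiftHom_apply (g : G) (φ : G → ℤ) (h : G) : shiftHom G g φ h = φ (g⁻¹ * h) := by
  simp [shiftHom]

/-- The action of mixed words on integer-valued functions for which group elements act by left
translation and the variable acts by adding `δ`. -/
def mixedAction (δ : G → ℤ) : Monoid.Coprod G (FreeGroup Unit) →* Equiv.Perm (G → ℤ) :=
  Monoid.Coprod.lift (shiftHom G) (FreeGroup.lift fun _ => Equiv.addRight δ)

theorem supDist_mixedAction (δ : G → ℤ) (w : Monoid.Coprod G (FreeGroup Unit)) :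
    ∀ φ ψ : G → ℤ, supDist (mixedAction δ w φ) (mixedAction δ w ψ) = supDist φ ψ := by
  induction w using Monoid.Coprod.induction_on with
  | inl g =>
    intro φ ψ
    simp only [mixedAction, Monoid.Coprod.lift_apply_inl, supDist, shiftHom_apply]
    exact (Equiv.mulLeft g⁻¹).iSup_comp (g := fun h => ((φ h - ψ h).natAbs : ℕ∞))
  | inr x =>
    simp only [mixedAction, Monoid.Coprod.lift_apply_inr]
    induction x using FreeGroup.induction_on with
    | C1 => simp
    | of _ => intro φ ψ; simp [supDist]
    | inv_of _ _ => intro φ ψ; simp [supDist]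
    | mul x y hx hy =>
      intro φ ψ
      rw [map_mul, Equiv.Perm.mul_apply, Equiv.Perm.mul_apply, hx, hy]
  | mul u v hu hv =>
    intro φ ψ
    rw [map_mul, Equiv.Perm.mul_apply, Equiv.Perm.mul_apply, hu, hv]

/-- A consistent tuple of distances extends to a Katetov function. -/
theorem Consistent.exists_katetov {ℓ : G → ℕ} (hℓ : IsLengthFun ℓ) {n : ℕ} [Nonempty (Fin n)]
    {a : Fin n → G} {d : Fin n → ℕ} (hd : Consistent ℓ a d) :
    ∃ f : G → ℕ, (∀ i, f (a i) = d i) ∧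
      ∀ i h, f h ≤ ℓ ((a i)⁻¹ * h) + d i ∧ ℓ ((a i)⁻¹ * h) ≤ f h + d i := by
  have hle : ∀ i h, ⨅ j, (ℓ ((a j)⁻¹ * h) + d j) ≤ ℓ ((a i)⁻¹ * h) + d i := fun i h =>
    ciInf_le (OrderBot.bddBelow _) i
  refine ⟨fun h => ⨅ j, (ℓ ((a j)⁻¹ * h) + d j), fun i => le_antisymm ?_ ?_,
    fun i h => ⟨hle i h, ?_⟩⟩
  · simpa [(hℓ.1 1).2 rfl] using hle i (a i)
  · refine le_ciInf fun j => ?_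
    have h1 := hℓ.2.1 ((a i)⁻¹ * a j)
    rw [mul_inv_rev, inv_inv] at h1
    rw [h1]
    exact (hd i j).1
  · obtain ⟨j, hj⟩ := ciInf_mem fun j => ℓ ((a j)⁻¹ * h) + d j
    have h1 := hℓ.2.2 ((a i)⁻¹ * a j) ((a j)⁻¹ * h)
    have h2 := (hd i j).2
    rw [mul_assoc, mul_inv_cancel_left] at h1
    dsimp only at hj ⊢
    omega

/-- A length function extends to a seminorm on mixed words in which the variable realizes
a prescribed consistent tuple of distances. -/
theorem Consistent.exists_seminorm {ℓ : G → ℕ} (hℓ : IsLengthFun ℓ) {n : ℕ} [Nonempty (Fin n)]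
    {a : Fin n → G} {d : Fin n → ℕ} (hd : Consistent ℓ a d) :
    ∃ L : Monoid.Coprod G (FreeGroup Unit) → ℕ∞, L 1 = 0 ∧ (∀ u, L u⁻¹ = L u) ∧
      (∀ u v, L (u * v) ≤ L u + L v) ∧ (∀ g, L (Monoid.Coprod.inl g) = ℓ g) ∧
      ∀ i, L ((Monoid.Coprod.inr (FreeGroup.of ()))⁻¹ * Monoid.Coprod.inl (a i)) = d i := by
  obtain ⟨f, hfa, hf⟩ := hd.exists_katetov hℓ
  let p : G → ℤ := fun h => ℓ h
  let δ : G → ℤ := fun h => f h - ℓ h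
  refine ⟨fun w => supDist (mixedAction δ w p) p, ?_, fun u => ?_, fun u v => ?_, fun g => ?_,
    fun i => ?_⟩
  · simp [supDist_self]
  · dsimp only
    rw [← supDist_mixedAction δ u, ← Equiv.Perm.mul_apply, ← map_mul, mul_inv_cancel, map_one,
      Equiv.Perm.one_apply, supDist_comm]
  · refine (supDist_triangle _ (mixedAction δ u p) _).trans ?_
    rw [map_mul, Equiv.Perm.mul_apply, supDist_mixedAction, add_comm]
  · have happ : ∀ h, mixedAction δ (Monoid.Coprod.inl g) p h - p h = ℓ (g⁻¹ * h) - ℓ h :=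
      fun h => by simp [mixedAction, shiftHom_apply, p]
    refine supDist_eq (h := 1) (fun h => ?_) ?_
    · have h1 := hℓ.2.2 g⁻¹ h
      have h2 := hℓ.2.2 g (g⁻¹ * h)
      rw [hℓ.2.1] at h1
      rw [mul_inv_cancel_left] at h2
      rw [happ, abs_le]
      omega
    · rw [happ, mul_one, hℓ.2.1, (hℓ.1 1).2 rfl]
      simp
  · have happ : ∀ h, mixedAction δ ((Monoid.Coprod.inr (FreeGroup.of ()))⁻¹ *
        Monoid.Coprod.inl (a i)) p h - p h = ℓ ((a i)⁻¹ * h) - f h := fun h => by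
      simp [mixedAction, shiftHom_apply, p, δ]
      ring
    refine supDist_eq (h := a i) (fun h => ?_) ?_
    · have := hf i h
      rw [happ, abs_le]
      omega
    · rw [happ, hfa, inv_mul_cancel, (hℓ.1 1).2 rfl]
      simp

end Extension

theorem isClopen_setOf_apply_mem {X Y : Type*} [TopologicalSpace X] [TopologicalSpace Y]
    [DiscreteTopology Y] {φ : X → Y} (hφ : Continuous φ) (s : Set Y) : IsClopen {x | φ x ∈ s} :=
  (isClopen_discrete s).preimage hφ

theorem stmt11 (G : Type) [Group G] [Countable G] (hG : MIF G)
    (n : ℕ) (a : Fin n → G) (d : Fin n → ℕ) :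
    IsOpen {ℓ : LengthFun G | Consistent ℓ.1 a d →
        ∃ g : G, ∀ i : Fin n, ℓ.1 (g⁻¹ * a i) = d i} ∧
    Dense {ℓ : LengthFun G | Consistent ℓ.1 a d →
        ∃ g : G, ∀ i : Fin n, ℓ.1 (g⁻¹ * a i) = d i} := by
  classical
  have hcont : ∀ g : G, Continuous fun ℓ : LengthFun G => ℓ.1 g := fun g =>
    (continuous_apply g).comp continuous_subtype_val
  constructor
  · have hcons : IsClosed {ℓ : LengthFun G | Consistent ℓ.1 a d} := by
      simp only [Consistent, Set.ofPred_forall]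
      exact isClosed_iInter fun i => isClosed_iInter fun j =>
        (isClopen_setOf_apply_mem (hcont ((a i)⁻¹ * a j))
          {m | d i ≤ m + d j ∧ m ≤ d i + d j}).isClosed
    simp only [imp_iff_not_or, Set.ofPred_or, Set.ofPred_exists, Set.ofPred_forall]
    exact hcons.isOpen_compl.union (isOpen_iUnion fun g => isOpen_iInter_of_finite fun i =>
      (isClopen_setOf_apply_mem (hcont (g⁻¹ * a i)) {d i}).isOpen)
  · refine dense_iff_inter_open.2 ?_
    rintro U hU ⟨ℓ, hℓU⟩
    by_cases hd : Consistent ℓ.1 a d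
    swap
    · exact ⟨ℓ, hℓU, fun h => absurd h hd⟩
    rcases isEmpty_or_nonempty (Fin n) with hn | hn
    · exact ⟨ℓ, hℓU, fun _ => ⟨1, fun i => isEmptyElim i⟩⟩
    by_cases hzero : ∃ i, d i = 0
    · obtain ⟨i, hi⟩ := hzero
      refine ⟨ℓ, hℓU, fun _ => ⟨a i, fun j => ?_⟩⟩
      have h1 := (hd i j).2
      have h2 := (hd j i).1
      rw [← ℓ.2.2.1, mul_inv_rev, inv_inv] at h2
      omega
    push Not at hzero
    obtain ⟨V, hV, rfl⟩ := isOpen_induced_iff.1 hU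
    obtain ⟨F, u, hu, huV⟩ := isOpen_pi_iff.1 hV ℓ.1 hℓU
    obtain ⟨L, h1, hinv, hmul, hinl, hdist⟩ := hd.exists_seminorm ℓ.2
    obtain ⟨g, ℓ', hℓ'⟩ := hG.exists_lengthFun L h1 hinv hmul
      (F.image Monoid.Coprod.inl ∪ Finset.univ.image fun i =>
        (Monoid.Coprod.inr (FreeGroup.of ()))⁻¹ * Monoid.Coprod.inl (a i)) (by
        simp only [Finset.mem_union, Finset.mem_image, Finset.mem_univ, true_and]
        rintro t (⟨h, _, rfl⟩ | ⟨i, rfl⟩) ht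
        · rw [hinl, Nat.cast_ne_zero, ne_eq, ℓ.2.1]
          rintro rfl
          exact ht (map_one _)
        · rw [hdist]
          exact_mod_cast hzero i) (by
        simp only [Finset.mem_union, Finset.mem_image, Finset.mem_univ, true_and]
        rintro t (⟨h, _, rfl⟩ | ⟨i, rfl⟩)
        · simp [hinl]
        · simp [hdist])
    refine ⟨ℓ', huV fun h hh => ?_, fun _ => ⟨g, fun i => ?_⟩⟩
    · have := hℓ' (Monoid.Coprod.inl h)
        (Finset.mem_union_left _ (Finset.mem_image_of_mem _ hh))
      rw [hinl, Monoid.Coprod.lift_apply_inl, MonoidHom.id_apply, Nat.cast_inj] at this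
      rw [this]
      exact (hu h hh).2
    · have := hℓ' ((Monoid.Coprod.inr (FreeGroup.of ()))⁻¹ * Monoid.Coprod.inl (a i))
        (Finset.mem_union_right _ (Finset.mem_image_of_mem _ (Finset.mem_univ i)))
      rw [hdist] at this
      simpa using this
end

section
/- For any countable MIF group G, the set C = ⋂_{g ∈ G∖{1}} C(g) is comeager in L(G); indeed, each C(g) is open and dense in L(G). -/
open Set Function Pointwise

section FreeProduct

open Monoid

variable {ι : Type*} {M : ι → Type*} [∀ i, Group (M i)]

/-- Reduced words that start and end in different factors do not commute. -/
theorem Monoid.CoprodI.NeWord.prod_mul_prod_ne {i j : ι} (hij : i ≠ j)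
    (u : CoprodI.NeWord M i i) (v : CoprodI.NeWord M j j) : u.prod * v.prod ≠ v.prod * u.prod := by
  classical
  intro h
  rw [← CoprodI.NeWord.append_prod (hne := hij), ← CoprodI.NeWord.append_prod (hne := hij.symm)] at h
  have h' := congrArg CoprodI.Word.toList (CoprodI.Word.equiv.symm.injective h)
  have h1 := (u.append hij v).toList_head?
  have h2 := (v.append hij.symm u).toList_head?
  change (u.append hij v).toList = (v.append hij.symm u).toList at h'
  rw [h', h2, Option.some_inj] at h1
  exact hij (congrArg Sigma.fst h1).symm

/-- In a free product of groups, a nontrivial element is conjugate to one whose reduced word starts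
and ends in a prescribed infinite factor. -/
theorem Monoid.CoprodI.exists_conj_eq_prod (j : ι) [Infinite (M j)] (u : CoprodI M) (hu : u ≠ 1) :
    ∃ (c : CoprodI M) (w : CoprodI.NeWord M j j), c * u * c⁻¹ = w.prod := by
  classical
  have key : ∀ {l : ι} (w : CoprodI.NeWord M j l), l ≠ j →
      ∃ (c : CoprodI M) (w' : CoprodI.NeWord M j j), c * w.prod * c⁻¹ = w'.prod := by
    intro l w hl
    obtain ⟨b, hb⟩ := (Set.toFinite ({1, w.head⁻¹} : Set (M j))).exists_notMem
    simp only [Set.mem_insert_iff, Set.mem_singleton_iff, not_or] at hb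
    refine ⟨CoprodI.of b, (w.mulHead b fun h => hb.2 (eq_inv_of_mul_eq_one_left h)).append hl
      (.singleton b⁻¹ (inv_ne_one.mpr hb.1)), ?_⟩
    simp
  obtain ⟨i, l, w, hw⟩ := CoprodI.NeWord.of_word (CoprodI.Word.equiv u) fun h => hu <| by
    rw [← CoprodI.Word.equiv.symm_apply_apply u, h]; simp [CoprodI.Word.equiv]
  have hwu : w.prod = u := by
    rw [CoprodI.NeWord.prod, hw]; exact CoprodI.Word.equiv.symm_apply_apply u
  rw [← hwu]
  by_cases hi : i = j
  · subst hi
    by_cases hl : l = i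
    · subst hl
      exact ⟨1, w, by simp⟩
    · exact key w hl
  · by_cases hl : l = j
    · subst hl
      obtain ⟨c, w', h⟩ := key w.inv hi
      refine ⟨c, w'.inv, ?_⟩
      rw [CoprodI.NeWord.inv_prod, ← h, CoprodI.NeWord.inv_prod]
      group
    · obtain ⟨b, hb⟩ := exists_ne (1 : M j)
      refine ⟨CoprodI.of b, ((CoprodI.NeWord.singleton b hb).append (Ne.symm hi) w).append hl
        (.singleton b⁻¹ (inv_ne_one.mpr hb)), ?_⟩
      simp

theorem Monoid.CoprodI.exists_conj_mul_ne (i j : ι) (hij : i ≠ j) [Nontrivial (M i)]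
    [Infinite (M j)] (u v : CoprodI M) (hu : u ≠ 1) (hv : v ≠ 1) :
    ∃ c : CoprodI M, u * (c * v * c⁻¹) ≠ (c * v * c⁻¹) * u := by
  obtain ⟨c, u', hu'⟩ := CoprodI.exists_conj_eq_prod j u hu
  obtain ⟨d, v', hv'⟩ := CoprodI.exists_conj_eq_prod j v hv
  obtain ⟨a, ha⟩ := exists_ne (1 : M i)
  have key := CoprodI.NeWord.prod_mul_prod_ne hij.symm u' (((CoprodI.NeWord.singleton a ha).append
    hij v').append hij.symm (.singleton a⁻¹ (inv_ne_one.mpr ha)))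
  refine ⟨c⁻¹ * CoprodI.of a * d, fun h => key ?_⟩
  simp only [CoprodI.NeWord.append_prod, CoprodI.NeWord.prod_singleton, ← hu', ← hv']
  simpa [mul_assoc] using congrArg (fun z => c * z * c⁻¹) h

/-- A two-element family of groups, indexed by `Bool`. -/
abbrev pairFamily (G H : Type) : Bool → Type
  | true => G
  | false => H

instance pairFamily.instGroup (G H : Type) [Group G] [Group H] : ∀ b, Group (pairFamily G H b)
  | true => ‹Group G›
  | false => ‹Group H›

/-- The comparison map from the binary free product to the indexed one. -/
def coprodToCoprodI (G H : Type) [Group G] [Group H] :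
    Coprod G H →* CoprodI (pairFamily G H) :=
  Coprod.lift (CoprodI.of (M := pairFamily G H) (i := true))
    (CoprodI.of (M := pairFamily G H) (i := false))

/-- The comparison map from the indexed free product to the binary one. -/
def coprodIToCoprod (G H : Type) [Group G] [Group H] :
    CoprodI (pairFamily G H) →* Coprod G H :=
  CoprodI.lift fun b => match b with
    | true => (Coprod.inl : G →* Coprod G H)
    | false => (Coprod.inr : H →* Coprod G H)

theorem coprodIToCoprod_coprodToCoprodI (G H : Type) [Group G] [Group H] (u : Coprod G H) :
    coprodIToCoprod G H (coprodToCoprodI G H u) = u := by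
  have : (coprodIToCoprod G H).comp (coprodToCoprodI G H) = MonoidHom.id _ := by
    apply Coprod.hom_ext
    · refine MonoidHom.ext fun x => ?_
      change coprodIToCoprod G H (CoprodI.of (M := pairFamily G H) (i := true) x) = _
      rw [coprodIToCoprod, CoprodI.lift_of]
      rfl
    · refine MonoidHom.ext fun x => ?_
      change coprodIToCoprod G H (CoprodI.of (M := pairFamily G H) (i := false) x) = _
      rw [coprodIToCoprod, CoprodI.lift_of]
      rfl
  exact DFunLike.congr_fun this u

theorem coprodToCoprodI_coprodIToCoprod (G H : Type) [Group G] [Group H]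
    (u : CoprodI (pairFamily G H)) : coprodToCoprodI G H (coprodIToCoprod G H u) = u := by
  have : (coprodToCoprodI G H).comp (coprodIToCoprod G H) = MonoidHom.id _ := by
    apply CoprodI.ext_hom
    rintro (_ | _)
    · ext x
      change coprodToCoprodI G H (coprodIToCoprod G H (CoprodI.of x)) = _
      rw [coprodIToCoprod, CoprodI.lift_of]
      rfl
    · ext x
      change coprodToCoprodI G H (coprodIToCoprod G H (CoprodI.of x)) = _
      rw [coprodIToCoprod, CoprodI.lift_of]
      rfl
  exact DFunLike.congr_fun this u

theorem Monoid.Coprod.exists_conj_mul_ne (G H : Type) [Group G] [Group H] [Nontrivial G]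
    [Infinite H] (u v : Coprod G H) (hu : u ≠ 1) (hv : v ≠ 1) :
    ∃ c : Coprod G H, u * (c * v * c⁻¹) ≠ (c * v * c⁻¹) * u := by
  have inj : Injective (coprodToCoprodI G H) :=
    LeftInverse.injective (coprodIToCoprod_coprodToCoprodI G H)
  have : Nontrivial (pairFamily G H true) := ‹Nontrivial G›
  have : Infinite (pairFamily G H false) := ‹Infinite H›
  obtain ⟨c, hc⟩ := CoprodI.exists_conj_mul_ne true false (by decide) (coprodToCoprodI G H u)
    (coprodToCoprodI G H v) ((map_ne_one_iff _ inj).mpr hu) ((map_ne_one_iff _ inj).mpr hv)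
  refine ⟨coprodIToCoprod G H c, fun h => hc ?_⟩
  simpa [coprodToCoprodI_coprodIToCoprod] using congrArg (coprodToCoprodI G H) h

end FreeProduct

section MixedIdentities

open Monoid

/-- Evaluation of a word with coefficients in `G` at an element of `G`. -/
abbrev evalWord {G : Type*} [Group G] (t : G) : Coprod G (FreeGroup Unit) →* G :=
  Coprod.lift (MonoidHom.id G) (FreeGroup.lift fun _ => t)

theorem MIF.exists_forall_ne_one_s13 {G : Type} [Group G] [Nontrivial G] (hG : MIF G)
    {S : Set (Coprod G (FreeGroup Unit))} (hS : S.Finite) (h1 : ∀ w ∈ S, w ≠ 1) :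
    ∃ t : G, ∀ w ∈ S, evalWord t w ≠ 1 := by
  suffices ∃ z : Coprod G (FreeGroup Unit), z ≠ 1 ∧
      ∀ t : G, evalWord t z ≠ 1 → ∀ w ∈ S, evalWord t w ≠ 1 by
    obtain ⟨z, hz, h⟩ := this
    obtain ⟨t, ht⟩ := hG z hz
    exact ⟨t, h t ht⟩
  induction S, hS using Set.Finite.induction_on with
  | empty =>
    obtain ⟨a, ha⟩ := exists_ne (1 : G)
    exact ⟨Coprod.inl a, (map_ne_one_iff _ Coprod.inl_injective).mpr ha, by simp⟩
  | @insert w S _ _ ih =>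
    obtain ⟨z, hz, h⟩ := ih fun w hw => h1 w (Set.mem_insert_of_mem _ hw)
    obtain ⟨c, hc⟩ := Coprod.exists_conj_mul_ne G (FreeGroup Unit) z w hz
      (h1 w (Set.mem_insert _ _))
    refine ⟨z * (c * w * c⁻¹) * (c * w * c⁻¹ * z)⁻¹, fun hzw => hc (mul_inv_eq_one.mp hzw), ?_⟩
    intro t ht v hv
    rcases Set.mem_insert_iff.mp hv with rfl | hv
    · intro hv1
      apply ht
      simp only [map_mul, map_inv, hv1]
      group
    · refine h t (fun hz1 => ht ?_) v hv
      simp only [map_mul, map_inv, hz1]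
      group

end MixedIdentities

section WeightedProducts

/-- `IsWeightedProd S a n` holds if `a` is a product of letters from the weighted alphabet `S`
of total weight `n`. -/
inductive IsWeightedProd {H : Type*} [Group H] (S : Set (H × ℕ)) : H → ℕ → Prop
  | one : IsWeightedProd S 1 0
  | mul {a b : H} {m n : ℕ} (ha : (a, m) ∈ S) (hb : IsWeightedProd S b n) :
    IsWeightedProd S (a * b) (m + n)

namespace IsWeightedProd

variable {H : Type*} [Group H] {S : Set (H × ℕ)}

theorem of_mem {a : H} {n : ℕ} (h : (a, n) ∈ S) : IsWeightedProd S a n := by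
  simpa using mul h one

theorem mul_mul {a b : H} {m n : ℕ} (ha : IsWeightedProd S a m) (hb : IsWeightedProd S b n) :
    IsWeightedProd S (a * b) (m + n) := by
  induction ha with
  | one => simpa using hb
  | mul h _ ih => rw [mul_assoc, add_assoc]; exact mul h ih

theorem inv (hS : ∀ a n, (a, n) ∈ S → (a⁻¹, n) ∈ S) {a : H} {n : ℕ}
    (ha : IsWeightedProd S a n) : IsWeightedProd S a⁻¹ n := by
  induction ha with
  | one => simpa using one
  | mul h _ ih =>
    rw [mul_inv_rev, add_comm]
    exact ih.mul_mul (of_mem (hS _ _ h))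

theorem eq_one (hS : ∀ a n, (a, n) ∈ S → 1 ≤ n) {a : H} (ha : IsWeightedProd S a 0) : a = 1 := by
  generalize hn : 0 = n at ha
  cases ha with
  | one => rfl
  | mul h _ => have := hS _ _ h; omega

theorem finite_le (hfin : S.Finite) (hS : ∀ a n, (a, n) ∈ S → 1 ≤ n) (N : ℕ) :
    {a : H | ∃ n ≤ N, IsWeightedProd S a n}.Finite := by
  induction N with
  | zero =>
    refine (Set.finite_singleton (1 : H)).subset ?_
    rintro a ⟨n, hn, ha⟩
    obtain rfl : n = 0 := by omega
    exact ha.eq_one hS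
  | succ N ih =>
    refine ((Set.finite_singleton (1 : H)).union
      (Set.Finite.image2 (fun (s : H × ℕ) b => s.1 * b) hfin ih)).subset ?_
    rintro a ⟨n, hn, ha⟩
    cases ha with
    | one => exact Or.inl rfl
    | @mul a b m n h hb =>
      have := hS _ _ h
      exact Or.inr ⟨(a, m), h, b, ⟨n, by omega, hb⟩, rfl⟩

/-- If a product over the image of `S` together with extra letters of weight at least `M` has total
weight less than `M`, then it lifts to a product over `S`. -/
theorem lift {G : Type*} [Group G] (f : H →* G) {T : Set (G × ℕ)} {M : ℕ}
    (hT : ∀ a n, (a, n) ∈ T → M ≤ n) {a : G} {n : ℕ}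
    (ha : IsWeightedProd (Prod.map f id '' S ∪ T) a n) (hn : n < M) :
    ∃ k, IsWeightedProd S k n ∧ f k = a := by
  induction ha with
  | one => exact ⟨1, one, map_one f⟩
  | mul h _ ih =>
    obtain ⟨k, hk, rfl⟩ := ih (by omega)
    rcases h with ⟨⟨b, m⟩, hb, h⟩ | h
    · obtain ⟨rfl, rfl⟩ := Prod.ext_iff.mp h
      exact ⟨b * k, mul hb hk, map_mul f b k⟩
    · have := hT _ _ h
      omega

theorem isLengthFun_sInf (hinv : ∀ a n, (a, n) ∈ S → (a⁻¹, n) ∈ S)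
    (hpos : ∀ a n, (a, n) ∈ S → 1 ≤ n) (hex : ∀ a : H, ∃ n, IsWeightedProd S a n) :
    IsLengthFun fun a : H => sInf {n | IsWeightedProd S a n} := by
  refine ⟨fun a => ⟨fun h => ?_, ?_⟩, fun a => ?_, fun a b => ?_⟩
  · have h' : IsWeightedProd S a (sInf {n | IsWeightedProd S a n}) := Nat.sInf_mem (hex a)
    dsimp only at h
    rw [h] at h'
    exact h'.eq_one hpos
  · rintro rfl
    exact Nat.le_zero.mp (Nat.sInf_le one)
  · dsimp only
    congr 1
    ext n
    exact ⟨fun h => by simpa using h.inv hinv, fun h => h.inv hinv⟩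
  · exact Nat.sInf_le (mul_mul (Nat.sInf_mem (hex a)) (Nat.sInf_mem (hex b)))

end IsWeightedProd

end WeightedProducts

section Displacement

/-- Two integer-valued functions are at sup-distance at most `m`. -/
def SupNear {X : Type*} (m : ℕ) (φ ψ : X → ℤ) : Prop :=
  ∀ x, |φ x - ψ x| ≤ m

/-- A sup-isometry moving the base point `φ₀` by at most `n`. -/
def DisplacesBy {X : Type*} (φ₀ : X → ℤ) (p : Equiv.Perm (X → ℤ)) (n : ℕ) : Prop :=
  (∀ m φ ψ, SupNear m (p φ) (p ψ) ↔ SupNear m φ ψ) ∧ SupNear n (p φ₀) φ₀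

namespace DisplacesBy

variable {X : Type*} {φ₀ : X → ℤ} {p q : Equiv.Perm (X → ℤ)} {m n : ℕ}

theorem one : DisplacesBy φ₀ 1 0 := ⟨fun _ _ _ => Iff.rfl, fun x => by simp⟩

theorem mul (hp : DisplacesBy φ₀ p m) (hq : DisplacesBy φ₀ q n) :
    DisplacesBy φ₀ (p * q) (m + n) := by
  refine ⟨fun k φ ψ => (hp.1 k _ _).trans (hq.1 k φ ψ), fun x => ?_⟩
  have h1 := (hp.1 n _ _).mpr hq.2 x
  have h2 := hp.2 x
  push_cast
  exact (abs_sub_le _ (p φ₀ x) _).trans (by rw [add_comm (m : ℤ)]; exact add_le_add h1 h2)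

theorem inv (hp : DisplacesBy φ₀ p n) : DisplacesBy φ₀ p⁻¹ n := by
  refine ⟨fun k φ ψ => ?_, ?_⟩
  · rw [← hp.1 k (p⁻¹ φ) (p⁻¹ ψ)]
    simp
  · rw [← hp.1 n]
    intro x
    have := hp.2 x
    rw [abs_sub_comm]
    simpa using this

end DisplacesBy

theorem IsWeightedProd.displacesBy {X H : Type*} [Group H] {S : Set (H × ℕ)} {φ₀ : X → ℤ}
    (f : H →* Equiv.Perm (X → ℤ)) (hS : ∀ a n, (a, n) ∈ S → DisplacesBy φ₀ (f a) n) {a : H} {n : ℕ}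
    (ha : IsWeightedProd S a n) : DisplacesBy φ₀ (f a) n := by
  induction ha with
  | one => rw [map_one]; exact DisplacesBy.one
  | mul h _ ih => rw [map_mul]; exact (hS _ _ h).mul ih

/-- Translation of integer-valued functions on a group. -/
def translatePerm (G : Type*) [Group G] : G →* Equiv.Perm (G → ℤ) where
  toFun g :=
    { toFun := fun φ x => φ (g⁻¹ * x)
      invFun := fun φ x => φ (g * x)
      left_inv := fun φ => by simp
      right_inv := fun φ => by simp }
  map_one' := by ext φ x; simp
  map_mul' g h := by ext φ x; simp [mul_assoc]

theorem translatePerm_apply {G : Type*} [Group G] (g : G) (φ : G → ℤ) (x : G) :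
    translatePerm G g φ x = φ (g⁻¹ * x) :=
  rfl

theorem supNear_translatePerm_iff {G : Type*} [Group G] (g : G) (m : ℕ) (φ ψ : G → ℤ) :
    SupNear m (translatePerm G g φ) (translatePerm G g ψ) ↔ SupNear m φ ψ := by
  refine ⟨fun h x => ?_, fun h x => ?_⟩
  · simpa [translatePerm_apply] using h (g * x)
  · simpa only [translatePerm_apply] using h (g⁻¹ * x)

namespace IsLengthFun

variable {G : Type*} [Group G] {ℓ : G → ℕ} (hℓ : IsLengthFun ℓ)

include hℓ

theorem displacesBy_translatePerm (g : G) :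
    DisplacesBy (fun x => (ℓ x : ℤ)) (translatePerm G g) (ℓ g) := by
  refine ⟨supNear_translatePerm_iff g, fun x => ?_⟩
  have h1 := hℓ.2.2 g (g⁻¹ * x)
  have h2 := hℓ.2.2 g⁻¹ x
  rw [mul_inv_cancel_left] at h1
  rw [hℓ.2.1] at h2
  simp only [translatePerm_apply, abs_le]
  constructor <;> omega

theorem le_of_displacesBy {g : G} {n : ℕ}
    (h : DisplacesBy (fun x => (ℓ x : ℤ)) (translatePerm G g) n) : ℓ g ≤ n := by
  have := h.2 1
  simp only [translatePerm_apply, mul_one, hℓ.2.1, (hℓ.1 1).mpr rfl] at this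
  simpa using this

/-- The midpoint-type isometry: it moves the base point to distance `ℓ g - 1` and lands at distance
`1` from the translate of the base point by `g`. -/
theorem exists_displacesBy (g : G) (hg : g ≠ 1) : ∃ p : Equiv.Perm (G → ℤ),
    DisplacesBy (fun x => (ℓ x : ℤ)) p (ℓ g - 1) ∧
    DisplacesBy (fun x => (ℓ x : ℤ)) (p⁻¹ * translatePerm G g) 1 := by
  have hpos : ℓ g ≠ 0 := fun h => hg ((hℓ.1 g).mp h)
  let u : G → ℤ := fun x =>
    max (-((ℓ g : ℤ) - 1)) (min ((ℓ g : ℤ) - 1) (ℓ (g⁻¹ * x) - ℓ x))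
  have iso : ∀ m φ ψ, SupNear m (Equiv.addRight u φ) (Equiv.addRight u ψ) ↔ SupNear m φ ψ :=
    fun m φ ψ => forall_congr' fun x => by simp
  refine ⟨Equiv.addRight u, ⟨iso, fun x => ?_⟩, fun m φ ψ => ?_, ?_⟩
  · simp only [Equiv.coe_addRight, Pi.add_apply, u]
    rw [abs_le]
    omega
  · rw [← iso, ← supNear_translatePerm_iff g m φ ψ]
    simp [Equiv.Perm.mul_apply]
  · rw [← iso]
    intro x
    have h := abs_le.mp ((hℓ.displacesBy_translatePerm g).2 x)
    simp only [translatePerm_apply] at h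
    have e : Equiv.addRight u (((Equiv.addRight u)⁻¹ * translatePerm G g) fun x => (ℓ x : ℤ)) =
        translatePerm G g fun x => (ℓ x : ℤ) :=
      Equiv.apply_symm_apply (Equiv.addRight u) _
    rw [e]
    simp only [translatePerm_apply, Equiv.coe_addRight, Pi.add_apply, u]
    rw [abs_le]
    omega

end IsLengthFun

end Displacement

section Density

open Monoid

/-- Every length function can be changed off a given finite set `F` so that `g` becomes a product
`h * k` with `h` of length `ℓ g - 1` and `k` of length `1`. -/
theorem MIF.exists_isLengthFun_eqOn {G : Type} [Group G] (hG : MIF G) {ℓ : G → ℕ}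
    (hℓ : IsLengthFun ℓ) (F : Finset G) {g : G} (hg : g ≠ 1) :
    ∃ ℓ' : G → ℕ, IsLengthFun ℓ' ∧ (∀ f ∈ F, ℓ' f = ℓ f) ∧
      ∃ h : G, ℓ' h = ℓ' g - 1 ∧ ℓ' (h⁻¹ * g) = 1 := by
  classical
  have pos : ∀ a : G, a ≠ 1 → 1 ≤ ℓ a := fun a ha =>
    Nat.one_le_iff_ne_zero.mpr fun h => ha ((hℓ.1 a).mp h)
  by_cases hN : ℓ g = 1
  · exact ⟨ℓ, hℓ, fun _ _ => rfl, 1, by rw [hN, (hℓ.1 1).mpr rfl], by simpa using hN⟩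
  have hN2 : 2 ≤ ℓ g := by have := pos g hg; omega
  have : Nontrivial G := ⟨g, 1, hg⟩
  let F' : Finset G := insert g F
  let M : ℕ := F'.sup ℓ + 1
  have hM : ∀ f ∈ F', ℓ f < M := fun f hf => Nat.lt_succ_of_le (Finset.le_sup hf)
  let x : Coprod G (FreeGroup Unit) := Coprod.inr (FreeGroup.of ())
  let ι : G →* Coprod G (FreeGroup Unit) := Coprod.inl
  -- the weighted alphabet in `G ∗ ⟨x⟩`
  let S₀ : Set (Coprod G (FreeGroup Unit) × ℕ) :=
    (fun f => (ι f, ℓ f)) '' {f | f ∈ F' ∧ f ≠ 1} ∪ {(x, ℓ g - 1), (x⁻¹ * ι g, 1)}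
  let S : Set (Coprod G (FreeGroup Unit) × ℕ) := S₀ ∪ (fun s => (s.1⁻¹, s.2)) '' S₀
  have hS₀pos : ∀ a n, (a, n) ∈ S₀ → 1 ≤ n := by
    rintro a n (⟨f, ⟨-, hf⟩, h⟩ | h | h)
    · obtain ⟨rfl, rfl⟩ := Prod.ext_iff.mp h
      exact pos f hf
    · obtain ⟨rfl, rfl⟩ := Prod.ext_iff.mp h
      dsimp only
      omega
    · obtain ⟨rfl, rfl⟩ := Prod.ext_iff.mp h
      exact le_rfl
  have hSpos : ∀ a n, (a, n) ∈ S → 1 ≤ n := by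
    rintro a n (h | ⟨⟨b, m⟩, hb, h⟩)
    · exact hS₀pos a n h
    · obtain ⟨rfl, rfl⟩ := Prod.ext_iff.mp h
      exact hS₀pos b m hb
  have hSinv : ∀ a n, (a, n) ∈ S → (a⁻¹, n) ∈ S := by
    rintro a n (h | ⟨⟨b, m⟩, hb, h⟩)
    · exact Or.inr ⟨_, h, rfl⟩
    · obtain ⟨rfl, rfl⟩ := Prod.ext_iff.mp h
      exact Or.inl (by simpa using hb)
  have hS₀fin : S₀.Finite :=
    ((F'.finite_toSet.subset fun f hf => hf.1).image _).union (Set.toFinite _)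
  have hSfin : S.Finite := hS₀fin.union (hS₀fin.image _)
  -- a product over this alphabet which lies in `G` is at least as heavy as its length
  have lower : ∀ f n, IsWeightedProd S (ι f) n → ℓ f ≤ n := by
    obtain ⟨p, hp1, hp2⟩ := hℓ.exists_displacesBy g hg
    let Φ : Coprod G (FreeGroup Unit) →* Equiv.Perm (G → ℤ) :=
      Coprod.lift (translatePerm G) (FreeGroup.lift fun _ => p)
    have hΦι : ∀ a, Φ (ι a) = translatePerm G a := fun a => Coprod.lift_apply_inl _ _ a
    have hΦx : Φ x = p := by simp [Φ, x]
    have hΦ₀ : ∀ a n, (a, n) ∈ S₀ → DisplacesBy (fun y => (ℓ y : ℤ)) (Φ a) n := by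
      rintro a n (⟨f, -, h⟩ | h | h)
      · obtain ⟨rfl, rfl⟩ := Prod.ext_iff.mp h
        rw [hΦι]
        exact hℓ.displacesBy_translatePerm f
      · obtain ⟨rfl, rfl⟩ := Prod.ext_iff.mp h
        rw [hΦx]
        exact hp1
      · obtain ⟨rfl, rfl⟩ := Prod.ext_iff.mp h
        rw [map_mul, map_inv, hΦx, hΦι]
        exact hp2
    intro f n hf
    apply hℓ.le_of_displacesBy
    rw [← hΦι]
    refine hf.displacesBy Φ ?_
    rintro a m (h | ⟨⟨b, k⟩, hb, h⟩)
    · exact hΦ₀ a m h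
    · obtain ⟨rfl, rfl⟩ := Prod.ext_iff.mp h
      rw [map_inv]
      exact (hΦ₀ b k hb).inv
  -- choose `t` avoiding accidental coincidences
  let W : Set (Coprod G (FreeGroup Unit)) :=
    Set.image2 (fun k f => k * (ι f)⁻¹) {k | ∃ n ≤ M, IsWeightedProd S k n} F' \ {1}
  have hW : W.Finite :=
    ((IsWeightedProd.finite_le hSfin hSpos M).image2 _ F'.finite_toSet).subset Set.sdiff_subset
  obtain ⟨t, ht⟩ := hG.exists_forall_ne_one_s13 hW fun w hw => hw.2
  let E : Coprod G (FreeGroup Unit) →* G := evalWord t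
  have hEι : ∀ a, E (ι a) = a := fun a => Coprod.lift_apply_inl _ _ a
  have hEx : E x = t := by simp [E, x]
  let T : Set (G × ℕ) := {s | s.2 = M}
  let A : Set (G × ℕ) := Prod.map E id '' S ∪ T
  have hAinv : ∀ a n, (a, n) ∈ A → (a⁻¹, n) ∈ A := by
    rintro a n (⟨⟨b, m⟩, hb, h⟩ | h)
    · obtain ⟨rfl, rfl⟩ := Prod.ext_iff.mp h
      exact Or.inl ⟨_, hSinv _ _ hb, by simp⟩
    · exact Or.inr h
  have hApos : ∀ a n, (a, n) ∈ A → 1 ≤ n := by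
    rintro a n (⟨⟨b, m⟩, hb, h⟩ | h)
    · obtain ⟨rfl, rfl⟩ := Prod.ext_iff.mp h
      exact hSpos _ _ hb
    · have h' : n = M := h
      omega
  have hℓ' := IsWeightedProd.isLengthFun_sInf hAinv hApos
    fun a => ⟨M, IsWeightedProd.of_mem (Or.inr rfl)⟩
  have upper : ∀ s ∈ S, sInf {n | IsWeightedProd A (E s.1) n} ≤ s.2 := fun s hs =>
    Nat.sInf_le (IsWeightedProd.of_mem (Or.inl ⟨s, hs, rfl⟩))
  have agree : ∀ f ∈ F', sInf {n | IsWeightedProd A f n} = ℓ f := by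
    intro f hf
    by_cases hf1 : f = 1
    · subst hf1
      rw [(hℓ.1 1).mpr rfl]
      exact (hℓ'.1 1).mpr rfl
    apply le_antisymm
    · have := upper (ι f, ℓ f) (Or.inl (Or.inl ⟨f, ⟨hf, hf1⟩, rfl⟩))
      rwa [hEι] at this
    · refine le_csInf ⟨M, IsWeightedProd.of_mem (Or.inr rfl)⟩ fun n hn => ?_
      by_contra! hlt
      have hnM := hlt.trans (hM f hf)
      obtain ⟨k, hk, hkf⟩ := IsWeightedProd.lift (S := S) E (T := T) (M := M)
        (fun _ _ h => ge_of_eq h) hn hnM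
      by_cases hkι : k * (ι f)⁻¹ = 1
      · rw [mul_inv_eq_one.mp hkι] at hk
        exact absurd (lower f n hk) (not_le.mpr hlt)
      · refine ht _ ⟨⟨k, ⟨n, hnM.le, hk⟩, f, hf, rfl⟩, hkι⟩ ?_
        change E (k * (ι f)⁻¹) = 1
        rw [map_mul, map_inv, hkf, hEι, mul_inv_cancel]
  refine ⟨_, hℓ', fun f hf => agree f (Finset.mem_insert_of_mem hf), t, ?_⟩
  have h1 := upper (x, ℓ g - 1) (Or.inl (Or.inr (Or.inl rfl)))
  have h2 := upper (x⁻¹ * ι g, 1) (Or.inl (Or.inr (Or.inr rfl)))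
  have h3 := hℓ'.2.2 t (t⁻¹ * g)
  rw [mul_inv_cancel_left] at h3
  have h4 := agree g (Finset.mem_insert_self _ _)
  simp only [map_mul, map_inv, hEx, hEι] at h1 h2
  dsimp only at h3 ⊢
  rw [h4] at h3 ⊢
  omega

end Density

theorem stmt13 (G : Type) [Group G] [Countable G] (hG : MIF G) :
    (∀ g : G, g ≠ 1 →
      IsOpen {ℓ : LengthFun G | ∃ h : G, ℓ.1 h = ℓ.1 g - 1 ∧ ℓ.1 (h⁻¹ * g) = 1} ∧
      Dense {ℓ : LengthFun G | ∃ h : G, ℓ.1 h = ℓ.1 g - 1 ∧ ℓ.1 (h⁻¹ * g) = 1}) ∧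
    (⋂ g ∈ {g : G | g ≠ 1},
        {ℓ : LengthFun G | ∃ h : G, ℓ.1 h = ℓ.1 g - 1 ∧ ℓ.1 (h⁻¹ * g) = 1}) ∈
      residual (LengthFun G) := by
  have key : ∀ g : G, g ≠ 1 →
      IsOpen {ℓ : LengthFun G | ∃ h : G, ℓ.1 h = ℓ.1 g - 1 ∧ ℓ.1 (h⁻¹ * g) = 1} ∧
      Dense {ℓ : LengthFun G | ∃ h : G, ℓ.1 h = ℓ.1 g - 1 ∧ ℓ.1 (h⁻¹ * g) = 1} := by
    intro g hg
    constructor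
    · have hc : ∀ a : G, Continuous fun ℓ : LengthFun G => ℓ.1 a := fun a =>
        (continuous_apply a).comp continuous_subtype_val
      rw [Set.ofPred_exists]
      refine isOpen_iUnion fun h => ?_
      exact (isOpen_discrete {p : ℕ × ℕ × ℕ | p.1 = p.2.1 - 1 ∧ p.2.2 = 1}).preimage
        ((hc h).prodMk ((hc g).prodMk (hc (h⁻¹ * g))))
    · intro ℓ
      rw [mem_closure_iff]
      rintro _ ⟨O, hO, rfl⟩ hℓO
      obtain ⟨I, u, hu, hsub⟩ := isOpen_pi_iff.mp hO ℓ.1 hℓO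
      obtain ⟨ℓ', hℓ', hI, h⟩ := hG.exists_isLengthFun_eqOn ℓ.2 I hg
      exact ⟨⟨ℓ', hℓ'⟩, hsub fun a ha => mem_of_eq_of_mem (hI a ha) (hu a ha).2, h⟩
  exact ⟨key, (countable_bInter_mem (Set.to_countable _)).mpr fun g hg =>
    residual_of_dense_open (key g hg).1 (key g hg).2⟩
end

section
/- For any countably infinite group G, the sets R₁ = {(ℓ₁,ℓ₂) ∈ L(G)×L(G) : ℓ₁ ⋠ ℓ₂} and R₂ = {(ℓ₁,ℓ₂) ∈ L(G)×L(G) : ℓ₂ ⋠ ℓ₁} are dense Gδ (in particular, comeager) subsets of L(G)×L(G). -/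
open Set Function Pointwise

section Density

variable {G : Type*} [Group G]

/-- The product in `G` of a word in the letters of `G` and their formal inverses. -/
def signedProd (w : List (G × Bool)) : G :=
  (w.map fun p => if p.2 then p.1 else p.1⁻¹).prod

/-- The total weight of a word in the letters of `G` and their formal inverses. -/
def signedWeight (ω : G → ℕ) (w : List (G × Bool)) : ℕ :=
  (w.map fun p => ω p.1).sum

theorem weightLength_le (ω : G → ℕ) (w : List (G × Bool)) :
    weightLength ω (signedProd w) ≤ signedWeight ω w :=
  Nat.sInf_le ⟨w, rfl, rfl⟩

theorem weightLength_le_weight (ω : G → ℕ) (g : G) : weightLength ω g ≤ ω g := by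
  simpa [signedProd, signedWeight] using weightLength_le ω [(g, true)]

theorem exists_signedWeight_eq_weightLength (ω : G → ℕ) (g : G) :
    ∃ w : List (G × Bool), signedWeight ω w = weightLength ω g ∧ signedProd w = g :=
  Nat.sInf_mem (s := {N : ℕ | ∃ w : List (G × Bool),
    (w.map fun p => ω p.1).sum = N ∧ (w.map fun p => if p.2 then p.1 else p.1⁻¹).prod = g})
    ⟨ω g, [(g, true)], by simp, by simp⟩

theorem weightLength_mul_le (ω : G → ℕ) (g h : G) :
    weightLength ω (g * h) ≤ weightLength ω g + weightLength ω h := by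
  obtain ⟨v, hv, rfl⟩ := exists_signedWeight_eq_weightLength ω g
  obtain ⟨w, hw, rfl⟩ := exists_signedWeight_eq_weightLength ω h
  rw [← hv, ← hw]
  simpa [signedProd, signedWeight] using weightLength_le ω (v ++ w)

theorem weightLength_inv_le (ω : G → ℕ) (g : G) : weightLength ω g⁻¹ ≤ weightLength ω g := by
  obtain ⟨w, hw, rfl⟩ := exists_signedWeight_eq_weightLength ω g
  rw [← hw]
  have hprod : signedProd (w.reverse.map fun p => (p.1, !p.2)) = (signedProd w)⁻¹ := by
    rw [signedProd, signedProd, List.prod_inv_reverse]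
    simp only [List.map_reverse, List.map_map]
    congr 2
    refine List.map_congr_left fun p _ => ?_
    cases h : p.2 <;> simp [h]
  have hweight : signedWeight ω (w.reverse.map fun p => (p.1, !p.2)) = signedWeight ω w := by
    simp [signedWeight, List.map_reverse, List.sum_reverse, Function.comp_def]
  rw [← hprod, ← hweight]
  exact weightLength_le ω _

theorem IsLengthFun.map_signedProd_le {ℓ : G → ℕ} (hℓ : IsLengthFun ℓ) {ω : G → ℕ}
    (hω : ∀ g, ℓ g ≤ ω g) (w : List (G × Bool)) : ℓ (signedProd w) ≤ signedWeight ω w := by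
  induction w with
  | nil => simp [signedProd, signedWeight, (hℓ.1 1).2 rfl]
  | cons p w ih =>
    have hp : ℓ (if p.2 then p.1 else p.1⁻¹) ≤ ω p.1 := by
      split_ifs
      · exact hω _
      · rw [hℓ.2.1]; exact hω _
    simp only [signedProd, signedWeight, List.map_cons, List.prod_cons, List.sum_cons] at ih ⊢
    exact (hℓ.2.2 _ _).trans (add_le_add hp ih)

theorem IsLengthFun.le_weightLength {ℓ : G → ℕ} (hℓ : IsLengthFun ℓ) {ω : G → ℕ}
    (hω : ∀ g, ℓ g ≤ ω g) (g : G) : ℓ g ≤ weightLength ω g := by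
  obtain ⟨w, hw, rfl⟩ := exists_signedWeight_eq_weightLength ω g
  exact hw ▸ hℓ.map_signedProd_le hω w

theorem IsLengthFun.isLengthFun_weightLength {ℓ : G → ℕ} (hℓ : IsLengthFun ℓ) {ω : G → ℕ}
    (hω : ∀ g, ℓ g ≤ ω g) : IsLengthFun (weightLength ω) := by
  refine ⟨fun g => ⟨fun h => ?_, ?_⟩, fun g => ?_, weightLength_mul_le ω⟩
  · exact (hℓ.1 g).1 (Nat.le_zero.1 (h ▸ hℓ.le_weightLength hω g))
  · rintro rfl
    simpa [signedProd, signedWeight] using weightLength_le ω []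
  · refine (weightLength_inv_le ω g).antisymm ?_
    simpa using weightLength_inv_le ω g⁻¹

theorem finite_pow {M : Type*} [Monoid M] {s : Set M} (hs : s.Finite) (n : ℕ) :
    (s ^ n).Finite := by
  induction n with
  | zero => simp
  | succ n ih => exact pow_succ s n ▸ ih.mul hs

/-- Balls of a weight length are finite when the weight is finite-to-one and positive away
from the identity. -/
theorem finite_weightLength_le {ω : G → ℕ} (hpos : ∀ g, g ≠ 1 → 0 < ω g)
    (hfin : ∀ n, {g | ω g ≤ n}.Finite) (N : ℕ) : {g | weightLength ω g ≤ N}.Finite := by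
  let T : Set G := insert 1 ({g | ω g ≤ N} ∪ {g | ω g ≤ N}⁻¹)
  have hT : T.Finite := ((hfin N).union (hfin N).inv).insert 1
  have key : ∀ (w : List (G × Bool)) (n : ℕ), signedWeight ω w ≤ n → n ≤ N →
      signedProd w ∈ T ^ n := by
    intro w
    induction w with
    | nil =>
      intro n _ _
      exact Set.one_mem_pow (Set.mem_insert _ _)
    | cons p w ih =>
      intro n hn hnN
      simp only [signedProd, signedWeight, List.map_cons, List.prod_cons, List.sum_cons]
        at ih hn ⊢
      by_cases hp : p.1 = 1
      · simpa [hp] using ih n (by omega) hnN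
      · have := hpos _ hp
        obtain ⟨m, rfl⟩ : ∃ m, n = m + 1 := ⟨n - 1, by omega⟩
        rw [pow_succ']
        refine Set.mul_mem_mul (Set.mem_insert_of_mem _ ?_) (ih m (by omega) (by omega))
        have hpN : ω p.1 ≤ N := by omega
        cases p.2 <;> simp [hpN]
  refine (finite_pow hT N).subset fun g hg => ?_
  obtain ⟨w, hw, rfl⟩ := exists_signedWeight_eq_weightLength ω g
  exact key w N (hw.trans_le hg) le_rfl

theorem dense_lengthFun_of_forall_finset {S : Set (LengthFun G)}
    (h : ∀ (ℓ : LengthFun G) (F : Finset G), ∃ ℓ' ∈ S, ∀ g ∈ F, ℓ'.1 g = ℓ.1 g) : Dense S := by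
  rw [dense_iff_inter_open]
  rintro _ ⟨V, hV, rfl⟩ ⟨ℓ, hℓ⟩
  obtain ⟨F, u, hu, huV⟩ := isOpen_pi_iff.1 hV ℓ.1 hℓ
  obtain ⟨ℓ', hS, hF⟩ := h ℓ F
  refine ⟨ℓ', huV fun g hg => ?_, hS⟩
  rw [hF g hg]
  exact (hu g hg).2

theorem IsLengthFun.min_const {ℓ : G → ℕ} (hℓ : IsLengthFun ℓ) {N : ℕ} (hN : 0 < N) :
    IsLengthFun fun g => min (ℓ g) N := by
  refine ⟨fun g => ?_, fun g => by simp only [hℓ.2.1], fun g h => ?_⟩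
  · rw [← hℓ.1 g]
    dsimp only
    omega
  · have := hℓ.2.2 g h
    dsimp only
    omega

theorem dense_setOf_bddAbove_range : Dense {ℓ : LengthFun G | BddAbove (range ℓ.1)} := by
  refine dense_lengthFun_of_forall_finset fun ℓ F => ?_
  refine ⟨⟨_, ℓ.2.min_const (Nat.succ_pos (F.sup ℓ.1))⟩, ⟨F.sup ℓ.1 + 1, ?_⟩, fun g hg => ?_⟩
  · rintro _ ⟨g, rfl⟩
    exact min_le_right _ _
  · exact min_eq_left ((Finset.le_sup hg).trans (Nat.le_succ _))

theorem dense_setOf_not_bddAbove_range [Countable G] [Infinite G] :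
    Dense {ℓ : LengthFun G | ¬BddAbove (range ℓ.1)} := by
  classical
  obtain ⟨e, he⟩ := exists_injective_nat G
  refine dense_lengthFun_of_forall_finset fun ℓ F => ?_
  let ω : G → ℕ := fun g => ℓ.1 g + if g ∈ F then 0 else e g
  have hω : ∀ g, ℓ.1 g ≤ ω g := fun g => Nat.le_add_right _ _
  have hpos : ∀ g, g ≠ 1 → 0 < ω g := fun g hg =>
    (Nat.pos_of_ne_zero fun h => hg ((ℓ.2.1 g).1 h)).trans_le (hω g)
  have hfin : ∀ n, {g | ω g ≤ n}.Finite := by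
    intro n
    refine (F.finite_toSet.union ((Set.finite_Iic n).preimage he.injOn)).subset fun g hg => ?_
    by_cases hgF : g ∈ F
    · exact Or.inl hgF
    · right
      simp only [ω, hgF, if_false, mem_ofPred_eq] at hg
      simp only [mem_preimage, mem_Iic]
      omega
  refine ⟨⟨_, ℓ.2.isLengthFun_weightLength hω⟩, ?_, fun g hg => ?_⟩
  · rintro ⟨N, hN⟩
    refine Set.infinite_univ ((finite_weightLength_le hpos hfin N).subset fun g _ => ?_)
    exact hN ⟨g, rfl⟩
  · refine le_antisymm ((weightLength_le_weight ω g).trans ?_) (ℓ.2.le_weightLength hω g)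
    simp [ω, hg]

theorem not_preceq_of_not_bddAbove {ℓ₁ ℓ₂ : G → ℕ} (h₁ : ¬BddAbove (range ℓ₁))
    (h₂ : BddAbove (range ℓ₂)) : ¬Preceq ℓ₁ ℓ₂ := by
  rintro ⟨C, hC⟩
  obtain ⟨N, hN⟩ := h₂
  refine h₁ ⟨max (ℓ₁ 1) (C * N), ?_⟩
  rintro _ ⟨g, rfl⟩
  by_cases hg : g = 1
  · exact hg ▸ le_max_left _ _
  · exact (hC g hg).trans ((Nat.mul_le_mul_left C (hN ⟨g, rfl⟩)).trans (le_max_right _ _))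

theorem dense_setOf_not_preceq [Countable G] [Infinite G] :
    Dense {p : LengthFun G × LengthFun G | ¬Preceq p.1.1 p.2.1} :=
  (dense_setOf_not_bddAbove_range.prod dense_setOf_bddAbove_range).mono
    fun _ hp => not_preceq_of_not_bddAbove hp.1 hp.2

theorem isGδ_setOf_not_preceq :
    IsGδ {p : LengthFun G × LengthFun G | ¬Preceq p.1.1 p.2.1} := by
  have h : {p : LengthFun G × LengthFun G | ¬Preceq p.1.1 p.2.1} =
      ⋂ C : ℕ, ⋃ g : G, ⋃ _ : g ≠ 1, {p | C * p.2.1 g < p.1.1 g} := by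
    ext p
    simp [Preceq]
  rw [h]
  refine IsGδ.iInter_of_isOpen fun C => isOpen_iUnion fun g => isOpen_iUnion fun _ => ?_
  refine isOpen_lt (continuous_const.mul ?_) ?_
  · exact (continuous_apply g).comp (continuous_subtype_val.comp continuous_snd)
  · exact (continuous_apply g).comp (continuous_subtype_val.comp continuous_fst)

end Density

theorem stmt14 (G : Type) [Group G] [Countable G] [Infinite G] :
    IsGδ {p : LengthFun G × LengthFun G | ¬Preceq p.1.1 p.2.1} ∧
    Dense {p : LengthFun G × LengthFun G | ¬Preceq p.1.1 p.2.1} ∧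
    IsGδ {p : LengthFun G × LengthFun G | ¬Preceq p.2.1 p.1.1} ∧
    Dense {p : LengthFun G × LengthFun G | ¬Preceq p.2.1 p.1.1} := by
  exact ⟨isGδ_setOf_not_preceq, dense_setOf_not_preceq,
    isGδ_setOf_not_preceq.preimage continuous_swap,
    dense_setOf_not_preceq.preimage (Homeomorph.prodComm _ _).isOpenMap⟩
end
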